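/- Let h be a Hessenberg function for type A_{n−1}, and for each i = 1,…,n−1 fix a permutation w^{(i)} of the set {i+1, i+2, …, h(i)}. Then the classes ∏_{i=1}^{n−1} α_{i,w^{(i)}(h(i))}·α_{i,w^{(i)}(h(i)−1)}···α_{i,w^{(i)}(h(i)−m_i+1)}, indexed by tuples (m_1,…,m_{n−1}) with 0 ≤ m_i ≤ h(i)−i (an empty product being 1), form a basis of the ℝ-vector space R^{A}_{h} = ℝ[x_1,…,x_n]/(f^{A}_{1,h(1)},…,f^{A}_{n,h(n)}). -/

import Mathlib

open MvPolynomial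

noncomputable section

/-- The variable `x_k` (1-indexed) of `ℝ[x_1,…,x_n]`. -/
def xv (n : ℕ) (k : ℕ) : MvPolynomial (Fin n) ℝ :=
  if h : 1 ≤ k ∧ k ≤ n then X ⟨k - 1, by omega⟩ else 0

/-- The polynomial `f^{A}_{i,j} = Σ_{k=1}^{i}(∏_{ℓ=i+1}^{j}(x_k−x_ℓ))·x_k`. -/
def fAij (n i j : ℕ) : MvPolynomial (Fin n) ℝ :=
  ∑ k ∈ Finset.Icc 1 i, (∏ ℓ ∈ Finset.Icc (i + 1) j, (xv n k - xv n ℓ)) * xv n k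

/-- The ideal `(f^{A}_{1,h(1)}, …, f^{A}_{n,h(n)})`,
so that `R^{A}_h = ℝ[x_1,…,x_n]/IAh n h ≅ H^*(Hess(N,h);ℝ)` in type `A_{n-1}`. -/
def IAh (n : ℕ) (h : ℕ → ℕ) : Ideal (MvPolynomial (Fin n) ℝ) :=
  Ideal.span ((fun i => fAij n i (h i)) '' Set.Icc 1 n)

/-- The class of `∏_{i=1}^{n-1} α_{i,w⁽ⁱ⁾(h(i))}·α_{i,w⁽ⁱ⁾(h(i)−1)}···α_{i,w⁽ⁱ⁾(h(i)−m_i+1)}`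
in `R^{A}_h`, where `α_{i,j} = x_i − x_j`. -/
def basAh (n : ℕ) (h : ℕ → ℕ) (w : ℕ → Equiv.Perm ℕ)
    (m : (i : Fin (n - 1)) → Fin (h (i.val + 1) - (i.val + 1) + 1)) :
    MvPolynomial (Fin n) ℝ ⧸ IAh n h :=
  Ideal.Quotient.mk (IAh n h)
    (∏ i : Fin (n - 1), ∏ t ∈ Finset.range (m i : ℕ),
      (xv n (i.val + 1) - xv n (w (i.val + 1) (h (i.val + 1) - t))))


section Spanning

variable {S : Type*} [CommRing S]

/-- The product `∏_{i=s}^{n} α_{i,w⁽ⁱ⁾(h(i))}···α_{i,w⁽ⁱ⁾(h(i)−m_i+1)}` for `α_{i,j} = x_i − x_j`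
in an arbitrary ring. -/
def rootProd (n : ℕ) (h : ℕ → ℕ) (w : ℕ → Equiv.Perm ℕ) (x : ℕ → S) (s : ℕ) (m : ℕ → ℕ) : S :=
  ∏ i ∈ Finset.Icc s n, ∏ t ∈ Finset.range (m i), (x i - x (w i (h i - t)))

/-- The set of all products `rootProd` with `m_i ≤ h(i) − i`. -/
def rootProds (n : ℕ) (h : ℕ → ℕ) (w : ℕ → Equiv.Perm ℕ) (x : ℕ → S) (s : ℕ) : Set S :=
  rootProd n h w x s '' {m | ∀ i ∈ Finset.Icc s n, m i ≤ h i - i}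

theorem rootProd_eq_mul (n : ℕ) (h : ℕ → ℕ) (w : ℕ → Equiv.Perm ℕ) (x : ℕ → S) {s : ℕ}
    (hs : s ≤ n) (m : ℕ → ℕ) :
    rootProd n h w x s m =
      (∏ t ∈ Finset.range (m s), (x s - x (w s (h s - t)))) * rootProd n h w x (s + 1) m := by
  rw [rootProd, ← Finset.insert_Icc_add_one_left_eq_Icc hs, Finset.prod_insert (by simp)]
  rfl

theorem map_rootProd {S' : Type*} [CommRing S'] (φ : S →+* S') (n : ℕ) (h : ℕ → ℕ)
    (w : ℕ → Equiv.Perm ℕ) (x : ℕ → S) (s : ℕ) (m : ℕ → ℕ) :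
    φ (rootProd n h w x s m) = rootProd n h w (fun k => φ (x k)) s m := by
  simp [rootProd, map_prod]

theorem prod_range_sub_perm (σ : Equiv.Perm ℕ) (x : ℕ → S) (s b : ℕ)
    (hσ : ∀ j ∈ Finset.Icc (s + 1) b, σ j ∈ Finset.Icc (s + 1) b) :
    ∏ t ∈ Finset.range (b - s), (x s - x (σ (b - t))) =
      ∏ l ∈ Finset.Icc (s + 1) b, (x s - x l) := by
  have himage : (Finset.Icc (s + 1) b).image σ = Finset.Icc (s + 1) b := by
    refine Finset.eq_of_subset_of_card_le (Finset.image_subset_iff.2 hσ) ?_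
    rw [Finset.card_image_of_injective _ σ.injective]
  conv_rhs => rw [← himage, Finset.prod_image σ.injective.injOn]
  refine Finset.prod_nbij' (fun t => b - t) (fun l => b - l) ?_ ?_ ?_ ?_ ?_ <;>
    intro t ht <;> simp at ht ⊢ <;> omega

variable [Algebra ℝ S]

theorem mem_of_forall_prod_range_mul_mem (V W : Submodule ℝ S) (N : ℕ) (β : ℕ → S) (z : S)
    (hβ : ∀ t < N, ∀ a : S, ∃ v ∈ V, ∃ b, a = v + β t * b)
    (hz : ∀ a : S, ∃ v ∈ V, ∃ b, a = v + z * b)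
    (hzero : (∏ t ∈ Finset.range N, β t) * z = 0)
    (hW : ∀ m ≤ N, ∀ v ∈ V, (∏ t ∈ Finset.range m, β t) * v ∈ W) (a : S) : a ∈ W := by
  have key : ∀ k ≤ N, ∀ a : S, (∏ t ∈ Finset.range (N - k), β t) * a ∈ W := by
    intro k
    induction k with
    | zero =>
      intro _ a
      obtain ⟨v, hv, b, rfl⟩ := hz a
      rw [Nat.sub_zero, mul_add, ← mul_assoc, hzero, zero_mul, add_zero]
      exact hW N le_rfl v hv
    | succ k ih =>
      intro hk a
      obtain ⟨v, hv, b, rfl⟩ := hβ (N - (k + 1)) (by omega) a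
      rw [mul_add, ← mul_assoc, ← Finset.prod_range_succ,
        show N - (k + 1) + 1 = N - k by omega]
      exact W.add_mem (hW _ (by omega) v hv) (ih (by omega) b)
  simpa using key N le_rfl a

/-- Spanning modulo an ideal follows from spanning in the quotient. -/
theorem exists_sub_mem_of_span_quotient (n : ℕ) (h : ℕ → ℕ) (w : ℕ → Equiv.Perm ℕ) (x : ℕ → S)
    (s : ℕ) (I : Ideal S)
    (hspan : Submodule.span ℝ (rootProds n h w (fun k => Ideal.Quotient.mk I (x k)) s) = ⊤)
    (a : S) : ∃ v ∈ Submodule.span ℝ (rootProds n h w x s), a - v ∈ I := by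
  let φ := Ideal.Quotient.mkₐ ℝ I
  have himage : rootProds n h w (fun k => Ideal.Quotient.mk I (x k)) s =
      φ.toLinearMap '' rootProds n h w x s := by
    rw [rootProds, rootProds, Set.image_image]
    exact Set.image_congr fun m _ => (map_rootProd (Ideal.Quotient.mk I) n h w x s m).symm
  have ha : φ.toLinearMap a ∈ (Submodule.span ℝ (rootProds n h w x s)).map φ.toLinearMap := by
    rw [Submodule.map_span, ← himage, hspan]
    trivial
  obtain ⟨v, hv, hva⟩ := ha
  exact ⟨v, hv, Ideal.Quotient.eq.1 hva.symm⟩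

/-- An algebra generated by `x_s,…,x_n` that satisfies the relations `f_{i,h(i)} = 0` weighted by
positive reals `c_k` is spanned by the products of the `α_{i,j}`. -/
theorem span_rootProds_eq_top (n : ℕ) (h : ℕ → ℕ) (w : ℕ → Equiv.Perm ℕ)
    (hle : ∀ i ∈ Finset.Icc 1 n, i ≤ h i ∧ h i ≤ n)
    (hmono : ∀ i j, 1 ≤ i → i ≤ j → j ≤ n → h i ≤ h j)
    (hw : ∀ i ∈ Finset.Icc 1 n, ∀ j ∈ Finset.Icc (i + 1) (h i), w i j ∈ Finset.Icc (i + 1) (h i))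
    (r : ℕ) : ∀ (s : ℕ), 1 ≤ s → s + r = n + 1 →
    ∀ (S : Type) [CommRing S] [Algebra ℝ S] (x : ℕ → S) (c : ℕ → ℝ), (∀ k, 0 < c k) →
    Algebra.adjoin ℝ (x '' Set.Icc s n) = ⊤ →
    (∀ i ∈ Finset.Icc s n, ∑ k ∈ Finset.Icc s i,
      c k • ((∏ l ∈ Finset.Icc (i + 1) (h i), (x k - x l)) * x k) = 0) →
    Submodule.span ℝ (rootProds n h w x s) = ⊤ := by
  induction r with
  | zero =>
    intro s _ hsr S _ _ x c _ hgen _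
    obtain rfl : s = n + 1 := by omega
    have hone : rootProds n h w x (n + 1) = {1} := by
      ext y
      simp [rootProds, rootProd, eq_comm]
    rw [Set.Icc_eq_empty (by omega), Set.image_empty, Algebra.adjoin_empty] at hgen
    rw [hone, ← Submodule.one_eq_span, ← Algebra.toSubmodule_bot, hgen, Algebra.top_toSubmodule]
  | succ r ih =>
    intro s hs hsr S _ _ x c hc hgen hrel
    have hsn : s ≤ n := by omega
    have hquot : ∀ (z : S) (c' : ℕ → ℝ), (∀ k, 0 < c' k) →
        Ideal.Quotient.mk (Ideal.span {z}) (x s) ∈ Algebra.adjoin ℝ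
          ((fun k => Ideal.Quotient.mk (Ideal.span {z}) (x k)) '' Set.Icc (s + 1) n) →
        (∀ i ∈ Finset.Icc (s + 1) n, ∑ k ∈ Finset.Icc (s + 1) i, c' k •
          ((∏ l ∈ Finset.Icc (i + 1) (h i), (Ideal.Quotient.mk (Ideal.span {z}) (x k) -
            Ideal.Quotient.mk (Ideal.span {z}) (x l))) *
            Ideal.Quotient.mk (Ideal.span {z}) (x k)) = 0) →
        ∀ a, ∃ v ∈ Submodule.span ℝ (rootProds n h w x (s + 1)), ∃ b, a = v + z * b := by
      intro z c' hc' hxs hrel' a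
      suffices hspan : Submodule.span ℝ (rootProds n h w
          (fun k => Ideal.Quotient.mk (Ideal.span {z}) (x k)) (s + 1)) = ⊤ by
        obtain ⟨v, hv, hmem⟩ := exists_sub_mem_of_span_quotient n h w x (s + 1) _ hspan a
        obtain ⟨b, hb⟩ := Ideal.mem_span_singleton'.1 hmem
        exact ⟨v, hv, b, by linear_combination -hb⟩
      refine ih (s + 1) (by omega) (by omega) _ _ c' hc' ?_ hrel'
      have hmap := congrArg (Subalgebra.map (Ideal.Quotient.mkₐ ℝ (Ideal.span {z}))) hgen
      rw [AlgHom.map_adjoin, Algebra.map_top,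
        (AlgHom.range_eq_top _).2 (Ideal.Quotient.mkₐ_surjective _ _)] at hmap
      rw [eq_top_iff, ← hmap, Algebra.adjoin_le_iff]
      rintro _ ⟨_, ⟨k, hk, rfl⟩, rfl⟩
      rcases eq_or_lt_of_le hk.1 with rfl | hlt
      · exact hxs
      · exact Algebra.subset_adjoin ⟨k, ⟨hlt, hk.2⟩, rfl⟩
    -- The weighted relations of the quotient by `z`, with the term `k = s` split off.
    have hsplit : ∀ (z : S), ∀ i ∈ Finset.Icc (s + 1) n,
        c s • ((∏ l ∈ Finset.Icc (i + 1) (h i), (Ideal.Quotient.mk (Ideal.span {z}) (x s) -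
            Ideal.Quotient.mk (Ideal.span {z}) (x l))) *
            Ideal.Quotient.mk (Ideal.span {z}) (x s)) +
        ∑ k ∈ Finset.Icc (s + 1) i, c k •
          ((∏ l ∈ Finset.Icc (i + 1) (h i), (Ideal.Quotient.mk (Ideal.span {z}) (x k) -
            Ideal.Quotient.mk (Ideal.span {z}) (x l))) *
            Ideal.Quotient.mk (Ideal.span {z}) (x k)) = 0 := by
      intro z i hi
      rw [Finset.mem_Icc] at hi
      have hi0 := congrArg (Ideal.Quotient.mkₐ ℝ (Ideal.span {z}))
        (hrel i (Finset.mem_Icc.2 ⟨by omega, hi.2⟩))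
      rw [← Finset.insert_Icc_add_one_left_eq_Icc (by omega : s ≤ i),
        Finset.sum_insert (by simp)] at hi0
      simpa only [map_add, map_sum, map_smul, map_mul, map_prod, map_sub, map_zero,
        Ideal.Quotient.mkₐ_eq_mk] using hi0
    have hzero : (∏ t ∈ Finset.range (h s - s), (x s - x (w s (h s - t)))) * x s = 0 := by
      rw [prod_range_sub_perm _ _ _ _ (hw s (Finset.mem_Icc.2 ⟨hs, hsn⟩))]
      have := hrel s (Finset.mem_Icc.2 ⟨le_rfl, hsn⟩)
      rw [Finset.Icc_self, Finset.sum_singleton] at this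
      exact (smul_eq_zero_iff_right (hc s).ne').1 this
    rw [eq_top_iff]
    intro a _
    refine mem_of_forall_prod_range_mul_mem (Submodule.span ℝ (rootProds n h w x (s + 1))) _
      (h s - s) (fun t => x s - x (w s (h s - t))) (x s) ?_ ?_ hzero ?_ a
    · intro t ht
      have hj := hw s (Finset.mem_Icc.2 ⟨hs, hsn⟩) (h s - t) (Finset.mem_Icc.2 (by omega))
      generalize w s (h s - t) = j at hj
      rw [Finset.mem_Icc] at hj
      have hjn : j ≤ n := hj.2.trans (hle s (Finset.mem_Icc.2 ⟨hs, hsn⟩)).2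
      have hxj : Ideal.Quotient.mk (Ideal.span {x s - x j}) (x s) =
          Ideal.Quotient.mk (Ideal.span {x s - x j}) (x j) :=
        Ideal.Quotient.eq.2 (Ideal.mem_span_singleton_self _)
      refine hquot (x s - x j) (fun k => c k + if k = j then c s else 0) ?_ ?_ ?_
      · intro k
        have := hc k
        have := hc s
        split_ifs <;> linarith
      · rw [hxj]
        exact Algebra.subset_adjoin ⟨j, ⟨hj.1, hjn⟩, rfl⟩
      · intro i hi
        rw [← hsplit (x s - x j) i hi, hxj]
        rw [Finset.mem_Icc] at hi
        simp only [add_smul, Finset.sum_add_distrib, ite_smul, zero_smul, Finset.sum_ite_eq']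
        rw [add_comm]
        congr 1
        split_ifs with hji
        · rfl
        · have hij : j ∈ Finset.Icc (i + 1) (h i) := by
            have := hmono s i hs (by omega) hi.2
            rw [Finset.mem_Icc] at hji ⊢
            omega
          rw [Finset.prod_eq_zero hij (sub_self _), zero_mul, smul_zero]
    · have hx0 : Ideal.Quotient.mk (Ideal.span {x s}) (x s) = 0 :=
        Ideal.Quotient.eq_zero_iff_mem.2 (Ideal.mem_span_singleton_self _)
      refine hquot (x s) c hc ?_ ?_
      · rw [hx0]
        exact Subalgebra.zero_mem _
      · intro i hi
        have := hsplit (x s) i hi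
        rwa [hx0, mul_zero, smul_zero, zero_add] at this
    · intro m hm v hv
      induction hv using Submodule.span_induction with
      | mem v hv =>
        obtain ⟨m', hm', rfl⟩ := hv
        refine Submodule.subset_span ⟨Function.update m' s m, ?_, ?_⟩
        · intro i hi
          rcases eq_or_ne i s with rfl | his
          · simpa using hm
          · rw [Function.update_of_ne his]
            rw [Finset.mem_Icc] at hi
            exact hm' i (Finset.mem_Icc.2 (by omega))
        · rw [rootProd_eq_mul n h w x hsn, Function.update_self]
          congr 1
          refine Finset.prod_congr rfl fun i hi => ?_
          rw [Finset.mem_Icc] at hi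
          rw [Function.update_of_ne (by omega)]
      | zero => simp
      | add u v _ _ hu hv => rw [mul_add]; exact Submodule.add_mem _ hu hv
      | smul r v _ hv => rw [mul_smul_comm]; exact Submodule.smul_mem _ _ hv

end Spanning

section Graded

variable {σ : Type*} [Fintype σ]

/-- The linear endomorphism of `ℝ[x]` that sends `x^e` to `B_{e mod d} · ∏ G_i ^ (e_i / d_i)`. -/
def divModMap (d : σ → ℕ) (B : (σ → ℕ) → MvPolynomial σ ℝ) (G : σ → MvPolynomial σ ℝ) :
    MvPolynomial σ ℝ →ₗ[ℝ] MvPolynomial σ ℝ :=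
  (basisMonomials σ ℝ).constr ℝ fun e => B (fun i => e i % d i) * ∏ i, G i ^ (e i / d i)

variable {d : σ → ℕ} {B : (σ → ℕ) → MvPolynomial σ ℝ} {G : σ → MvPolynomial σ ℝ}

theorem divModMap_monomial (e : σ →₀ ℕ) :
    divModMap d B G (monomial e 1) = B (fun i => e i % d i) * ∏ i, G i ^ (e i / d i) := by
  exact (basisMonomials σ ℝ).constr_basis ℝ _ e

theorem divModMap_monomial_of_lt (e : σ →₀ ℕ) (he : ∀ i, e i < d i) :
    divModMap d B G (monomial e 1) = B e := by
  rw [divModMap_monomial]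
  simp [Nat.div_eq_of_lt (he _), Nat.mod_eq_of_lt (he _)]

theorem divModMap_X_pow_mul (hd : ∀ i, 0 < d i) (j : σ) (p : MvPolynomial σ ℝ) :
    divModMap d B G (X j ^ d j * p) = G j * divModMap d B G p := by
  classical
  induction p using MvPolynomial.induction_on' with
  | add p q hp hq => rw [mul_add, map_add, map_add, mul_add, hp, hq]
  | monomial e a =>
    rw [← mul_one a, ← smul_eq_mul (a := a), ← smul_monomial, mul_smul_comm, map_smul, map_smul,
      mul_smul_comm, X_pow_eq_monomial, monomial_mul, one_mul, divModMap_monomial,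
      divModMap_monomial]
    have hmod : (fun i => (Finsupp.single j (d j) + e) i % d i) = fun i => e i % d i := by
      funext i
      rcases eq_or_ne j i with rfl | hji
      · simp
      · simp [Finsupp.single_eq_of_ne' hji]
    have hdiv : ∀ i, G i ^ ((Finsupp.single j (d j) + e) i / d i) =
        (if i = j then G j else 1) * G i ^ (e i / d i) := by
      intro i
      rcases eq_or_ne i j with rfl | hji
      · simp [Nat.add_div_left _ (hd i), pow_succ']
      · simp [Finsupp.single_eq_of_ne hji, hji]
    rw [hmod, Finset.prod_congr rfl fun i _ => hdiv i, Finset.prod_mul_distrib,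
      Finset.prod_ite_eq' Finset.univ j, if_pos (Finset.mem_univ j)]
    ring_nf

theorem isHomogeneous_divModMap_monomial (hB : ∀ r, (B r).IsHomogeneous (∑ i, r i))
    (hG : ∀ i, (G i).IsHomogeneous (d i)) (e : σ →₀ ℕ) :
    (divModMap d B G (monomial e 1)).IsHomogeneous e.degree := by
  rw [divModMap_monomial]
  have := (hB fun i => e i % d i).mul
    (IsHomogeneous.prod Finset.univ _ _ fun i _ => (hG i).pow (e i / d i))
  rwa [← Finset.sum_add_distrib, Finset.sum_congr rfl fun i _ => Nat.mod_add_div (e i) (d i),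
    ← Finsupp.degree_eq_sum] at this

theorem IsHomogeneous.divModMap (hB : ∀ r, (B r).IsHomogeneous (∑ i, r i))
    (hG : ∀ i, (G i).IsHomogeneous (d i)) {p : MvPolynomial σ ℝ} {D : ℕ}
    (hp : p.IsHomogeneous D) : (divModMap d B G p).IsHomogeneous D := by
  rw [p.as_sum, map_sum]
  refine IsHomogeneous.sum _ _ _ fun e he => ?_
  have hdeg : e.degree = D := of_not_not fun hne => mem_support_iff.1 he (hp.coeff_eq_zero hne)
  rw [← mul_one (coeff e p), ← smul_eq_mul, ← smul_monomial, map_smul, smul_eq_C_mul, ← hdeg]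
  exact (isHomogeneous_divModMap_monomial hB hG e).C_mul _

/-- If `ℝ[x]` is spanned by the `B_r`, `r < d`, modulo the ideal of the `G_i`, then it is spanned
by the `B_r` as a module over the subalgebra generated by the `G_i`. -/
theorem divModMap_surjective (hd : ∀ i, 0 < d i) (hB : ∀ r, (B r).IsHomogeneous (∑ i, r i))
    (hG : ∀ i, (G i).IsHomogeneous (d i))
    (hspan : ∀ a, ∃ v ∈ Submodule.span ℝ (B '' {r | ∀ i, r i < d i}),
      a - v ∈ Ideal.span (Set.range G)) :
    Function.Surjective (divModMap d B G) := by
  have key : ∀ D : ℕ, ∀ a : MvPolynomial σ ℝ, a.IsHomogeneous D →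
      a ∈ LinearMap.range (divModMap d B G) := by
    intro D
    induction D using Nat.strong_induction_on with
    | _ D ih =>
      intro a ha
      obtain ⟨v, hv, hav⟩ := hspan a
      have hcomp : ∀ E (p : MvPolynomial σ ℝ), p.IsHomogeneous E →
          (E = D → p ∈ LinearMap.range (divModMap d B G)) →
          homogeneousComponent D p ∈ LinearMap.range (divModMap d B G) := by
        intro E p hp hE
        rw [homogeneousComponent_of_mem hp]
        split_ifs with h
        · exact hE h.symm
        · exact Submodule.zero_mem _
      have hv' : homogeneousComponent D v ∈ LinearMap.range (divModMap d B G) := by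
        clear hav
        induction hv using Submodule.span_induction with
        | mem v hv =>
          obtain ⟨r, hr, rfl⟩ := hv
          exact hcomp _ _ (hB r) fun _ =>
            ⟨monomial (Finsupp.equivFunOnFinite.symm r) 1, divModMap_monomial_of_lt _ hr⟩
        | zero => rw [map_zero]; exact Submodule.zero_mem _
        | add u v _ _ hu hv => rw [map_add]; exact Submodule.add_mem _ hu hv
        | smul c v _ hv => rw [map_smul]; exact Submodule.smul_mem _ _ hv
      have hav' : homogeneousComponent D (a - v) ∈ LinearMap.range (divModMap d B G) := by
        obtain ⟨b, hb⟩ := (Submodule.mem_span_range_iff_exists_fun _).1 hav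
        rw [← hb, map_sum]
        refine Submodule.sum_mem _ fun i _ => ?_
        rw [← sum_homogeneousComponent (b i), smul_eq_mul, Finset.sum_mul, map_sum]
        refine Submodule.sum_mem _ fun k _ => ?_
        refine hcomp _ _ ((homogeneousComponent_isHomogeneous k (b i)).mul (hG i)) fun hk => ?_
        obtain ⟨p, hp⟩ := ih k (by have := hd i; omega) _
          (homogeneousComponent_isHomogeneous k (b i))
        exact ⟨X i ^ d i * p, by rw [divModMap_X_pow_mul hd, hp, mul_comm]⟩
      rw [← homogeneousComponent_eq_self ha, ← sub_add_cancel a v, map_add]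
      exact Submodule.add_mem _ hav' hv'
  rw [← LinearMap.range_eq_top, eq_top_iff]
  intro a _
  rw [← sum_homogeneousComponent a]
  exact Submodule.sum_mem _ fun k _ => key k _ (homogeneousComponent_isHomogeneous k a)

theorem divModMap_injective (hd : ∀ i, 0 < d i) (hB : ∀ r, (B r).IsHomogeneous (∑ i, r i))
    (hG : ∀ i, (G i).IsHomogeneous (d i))
    (hspan : ∀ a, ∃ v ∈ Submodule.span ℝ (B '' {r | ∀ i, r i < d i}),
      a - v ∈ Ideal.span (Set.range G)) :
    Function.Injective (divModMap d B G) := by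
  have hcomm : ∀ D p, homogeneousComponent D (divModMap d B G p) =
      divModMap d B G (homogeneousComponent D p) := by
    intro D p
    conv_lhs => rw [← sum_homogeneousComponent p]
    conv_rhs => rw [← sum_homogeneousComponent p]
    simp only [map_sum]
    refine Finset.sum_congr rfl fun k _ => ?_
    have hk := homogeneousComponent_isHomogeneous k p
    rw [homogeneousComponent_of_mem (IsHomogeneous.divModMap hB hG hk),
      homogeneousComponent_of_mem hk]
    split_ifs <;> simp
  have hsurj := divModMap_surjective hd hB hG hspan
  rw [injective_iff_map_eq_zero]
  intro p hp
  have hzero : ∀ D, homogeneousComponent D p = 0 := by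
    intro D
    have : FiniteDimensional ℝ (homogeneousSubmodule σ ℝ D) :=
      Module.Finite.iff_fg.2 (homogeneousSubmodule_fg σ ℝ D)
    let T : homogeneousSubmodule σ ℝ D →ₗ[ℝ] homogeneousSubmodule σ ℝ D :=
      (divModMap d B G).restrict fun q hq => IsHomogeneous.divModMap hB hG hq
    have hT : Function.Injective T := by
      rw [LinearMap.injective_iff_surjective]
      rintro ⟨a, ha⟩
      obtain ⟨q, rfl⟩ := hsurj a
      refine ⟨⟨homogeneousComponent D q, homogeneousComponent_mem D q⟩, Subtype.ext ?_⟩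
      change divModMap d B G (homogeneousComponent D q) = _
      rw [← hcomm, homogeneousComponent_eq_self ha]
    have := (injective_iff_map_eq_zero T).1 hT
      ⟨homogeneousComponent D p, homogeneousComponent_mem D p⟩
      (Subtype.ext (by change divModMap d B G (homogeneousComponent D p) = 0; rw [← hcomm, hp, map_zero]))
    exact congrArg Subtype.val this
  rw [← sum_homogeneousComponent p]
  exact Finset.sum_eq_zero fun k _ => hzero k

theorem linearIndependent_mk_of_span (hd : ∀ i, 0 < d i)
    (hB : ∀ r, (B r).IsHomogeneous (∑ i, r i)) (hG : ∀ i, (G i).IsHomogeneous (d i))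
    (hspan : ∀ a, ∃ v ∈ Submodule.span ℝ (B '' {r | ∀ i, r i < d i}),
      a - v ∈ Ideal.span (Set.range G)) :
    LinearIndependent ℝ (fun r : (i : σ) → Fin (d i) =>
      Ideal.Quotient.mk (Ideal.span (Set.range G)) (B fun i => r i)) := by
  classical
  rw [Fintype.linearIndependent_iff]
  intro c hc r
  let ex (r : (i : σ) → Fin (d i)) : σ →₀ ℕ := Finsupp.equivFunOnFinite.symm fun i => (r i : ℕ)
  have hex : Function.Injective ex := by
    intro r r' hr
    funext i
    exact Fin.ext (DFunLike.congr_fun hr i)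
  have hmem : ∑ r, c r • B (fun i => r i) ∈ Ideal.span (Set.range G) := by
    rw [← Ideal.Quotient.eq_zero_iff_mem, ← hc, ← Ideal.Quotient.mkₐ_eq_mk ℝ]
    simp only [map_sum, map_smul]
  obtain ⟨b, hb⟩ := (Submodule.mem_span_range_iff_exists_fun _).1 hmem
  choose p hp using fun i => divModMap_surjective hd hB hG hspan (b i)
  have hT : divModMap d B G (∑ r, c r • monomial (ex r) 1) =
      divModMap d B G (∑ i, X i ^ d i * p i) := by
    simp only [map_sum, map_smul]
    rw [Finset.sum_congr rfl fun i _ => divModMap_X_pow_mul hd i (p i)]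
    simp only [hp, mul_comm (G _), ← smul_eq_mul (b _)]
    rw [hb]
    exact Finset.sum_congr rfl fun r _ =>
      congrArg _ (divModMap_monomial_of_lt (ex r) fun i => (r i).isLt)
  have hcoeff := congrArg (coeff (ex r)) (divModMap_injective hd hB hG hspan hT)
  have hright : coeff (ex r) (∑ i, X i ^ d i * p i) = 0 := by
    rw [coeff_sum]
    refine Finset.sum_eq_zero fun i _ => ?_
    rw [X_pow_eq_monomial, coeff_monomial_mul', if_neg]
    intro hle
    have := hle i
    rw [Finsupp.single_eq_same] at this
    exact absurd this (not_le.2 (r i).isLt)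
  rw [hright, coeff_sum, Finset.sum_eq_single r] at hcoeff
  · simpa using hcoeff
  · intro r' _ hr'
    rw [coeff_smul, coeff_monomial, if_neg (fun h => hr' (hex h)), smul_zero]
  · simp

end Graded

section Hessenberg

theorem isHomogeneous_xv (n k : ℕ) : (xv n k).IsHomogeneous 1 := by
  unfold xv
  split_ifs
  · exact isHomogeneous_X ℝ _
  · exact isHomogeneous_zero _ _ _

theorem isHomogeneous_fAij (n i j : ℕ) : (fAij n i j).IsHomogeneous (j - i + 1) := by
  refine IsHomogeneous.sum _ _ _ fun k _ => IsHomogeneous.mul ?_ (isHomogeneous_xv n k)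
  have := IsHomogeneous.prod (Finset.Icc (i + 1) j) (fun l => xv n k - xv n l) (fun _ => 1)
    fun l _ => (isHomogeneous_xv n k).sub (isHomogeneous_xv n l)
  simpa using this

theorem adjoin_image_xv (n : ℕ) : Algebra.adjoin ℝ (xv n '' Set.Icc 1 n) = ⊤ := by
  rw [eq_top_iff, ← adjoin_range_X, Algebra.adjoin_le_iff]
  rintro _ ⟨i, rfl⟩
  refine Algebra.subset_adjoin ⟨i + 1, ⟨by omega, by omega⟩, ?_⟩
  rw [xv, dif_pos (by omega)]
  rfl

theorem IAh_eq_span_range (n : ℕ) (h : ℕ → ℕ) :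
    IAh n h = Ideal.span (Set.range fun i : Fin n => fAij n (i + 1) (h (i + 1))) := by
  rw [IAh]
  congr 1
  ext y
  constructor
  · rintro ⟨i, hi, rfl⟩
    refine ⟨⟨i - 1, by have := hi.1; have := hi.2; omega⟩, ?_⟩
    simp only [Nat.sub_add_cancel hi.1]
  · rintro ⟨i, rfl⟩
    exact ⟨i + 1, ⟨by omega, by omega⟩, rfl⟩

theorem rootProd_one {S : Type*} [CommRing S] (n : ℕ) (h : ℕ → ℕ) (w : ℕ → Equiv.Perm ℕ)
    (x : ℕ → S) (m : ℕ → ℕ) : rootProd n h w x 1 m =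
      ∏ i : Fin n, ∏ t ∈ Finset.range (m (i + 1)), (x (i + 1) - x (w (i + 1) (h (i + 1) - t))) := by
  rw [rootProd, ← Finset.Ico_add_one_right_eq_Icc, Finset.prod_Ico_eq_prod_range,
    Fin.prod_univ_eq_prod_range (fun i => ∏ t ∈ Finset.range (m (i + 1)),
      (x (i + 1) - x (w (i + 1) (h (i + 1) - t))))]
  simp only [Nat.add_sub_cancel, add_comm 1]

theorem span_rootProds_xv (n : ℕ) (h : ℕ → ℕ)
    (hh1 : ∀ i ∈ Finset.Icc 1 n, i ≤ h i ∧ h i ≤ n)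
    (hh2 : ∀ i ∈ Finset.Icc 1 (n - 1), h i ≤ h (i + 1)) (w : ℕ → Equiv.Perm ℕ)
    (hw : ∀ i ∈ Finset.Icc 1 (n - 1), ∀ j ∈ Finset.Icc (i + 1) (h i),
      w i j ∈ Finset.Icc (i + 1) (h i)) :
    Submodule.span ℝ (rootProds n h w (fun k => Ideal.Quotient.mk (IAh n h) (xv n k)) 1) = ⊤ := by
  refine span_rootProds_eq_top n h w hh1 ?_ ?_ n 1 le_rfl (by omega) _ _ (fun _ => 1)
    (fun _ => one_pos) ?_ ?_
  · intro i j hi hij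
    induction j, hij using Nat.le_induction with
    | base => exact fun _ => le_rfl
    | succ j hij ih =>
      exact fun hj => (ih (by omega)).trans (hh2 j (Finset.mem_Icc.2 (by omega)))
  · intro i hi j hj
    have hi' := hh1 i hi
    rw [Finset.mem_Icc] at hi
    refine hw i (Finset.mem_Icc.2 ?_) j hj
    rw [Finset.mem_Icc] at hj
    omega
  · have := congrArg (Subalgebra.map (Ideal.Quotient.mkₐ ℝ (IAh n h))) (adjoin_image_xv n)
    rwa [AlgHom.map_adjoin, Algebra.map_top,
      (AlgHom.range_eq_top _).2 (Ideal.Quotient.mkₐ_surjective _ _), Set.image_image] at this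
  · intro i hi
    have hmem : fAij n i (h i) ∈ IAh n h :=
      Ideal.subset_span ⟨i, Finset.mem_Icc.1 hi, rfl⟩
    rw [← Ideal.Quotient.eq_zero_iff_mem, fAij] at hmem
    simpa only [map_sum, map_mul, map_prod, map_sub, one_smul] using hmem

end Hessenberg

/-- **Theorem 5.2 (type A).** For a Hessenberg function `h` of type `A_{n-1}` and any choice
of permutations `w⁽ⁱ⁾` of `{i+1,…,h(i)}`, the classes
`∏_{i=1}^{n-1} α_{i,w⁽ⁱ⁾(h(i))}···α_{i,w⁽ⁱ⁾(h(i)−m_i+1)}`, `0 ≤ m_i ≤ h(i)−i`, form an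
ℝ-basis of `H^*(Hess(N,h)) ≅ R^{A}_h`. -/
theorem stmt_3 (n : ℕ) (hn : 1 ≤ n) (h : ℕ → ℕ)
    (hh1 : ∀ i ∈ Finset.Icc 1 n, i ≤ h i ∧ h i ≤ n)
    (hh2 : ∀ i ∈ Finset.Icc 1 (n - 1), h i ≤ h (i + 1))
    (w : ℕ → Equiv.Perm ℕ)
    (hw : ∀ i ∈ Finset.Icc 1 (n - 1), ∀ j ∈ Finset.Icc (i + 1) (h i),
      w i j ∈ Finset.Icc (i + 1) (h i)) :
    LinearIndependent ℝ (basAh n h w) ∧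
      Submodule.span ℝ (Set.range (basAh n h w)) = ⊤ := by
  obtain ⟨N, rfl⟩ : ∃ N, n = N + 1 := ⟨n - 1, by omega⟩
  have hspan := span_rootProds_xv (N + 1) h hh1 hh2 w hw
  have hlast : h (N + 1) - (N + 1) = 0 := by
    have := hh1 (N + 1) (Finset.mem_Icc.2 ⟨by omega, le_rfl⟩)
    omega
  constructor
  · let d : Fin (N + 1) → ℕ := fun i => h (i + 1) - (i + 1) + 1
    let B : (Fin (N + 1) → ℕ) → MvPolynomial (Fin (N + 1)) ℝ := fun r =>
      ∏ i, ∏ t ∈ Finset.range (r i),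
        (xv (N + 1) (i + 1) - xv (N + 1) (w (i + 1) (h (i + 1) - t)))
    have hB : ∀ r, (B r).IsHomogeneous (∑ i, r i) := by
      intro r
      refine IsHomogeneous.prod _ _ _ fun i _ => ?_
      have := IsHomogeneous.prod (Finset.range (r i))
        (fun t => xv (N + 1) (i + 1) - xv (N + 1) (w (i + 1) (h (i + 1) - t))) (fun _ => 1)
        fun t _ => (isHomogeneous_xv _ _).sub (isHomogeneous_xv _ _)
      simpa using this
    have hli := linearIndependent_mk_of_span (d := d) (B := B)
      (G := fun i => fAij (N + 1) (i + 1) (h (i + 1))) (fun i => Nat.succ_pos _) hB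
      (fun i => isHomogeneous_fAij _ _ _) (by
        intro a
        rw [← IAh_eq_span_range]
        obtain ⟨v, hv, hav⟩ := exists_sub_mem_of_span_quotient _ h w _ 1 _ hspan a
        refine ⟨v, Submodule.span_mono ?_ hv, hav⟩
        rintro _ ⟨m, hm, rfl⟩
        refine ⟨fun i => m (i + 1), fun i => ?_, (rootProd_one _ _ _ _ _).symm⟩
        exact Nat.lt_succ_of_le (hm (i + 1) (Finset.mem_Icc.2 (by omega))))
    rw [← IAh_eq_span_range] at hli
    let extend : ((i : Fin (N + 1 - 1)) → Fin (h (i.val + 1) - (i.val + 1) + 1)) →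
        (i : Fin (N + 1)) → Fin (d i) :=
      fun m i => if hi : i.val < N then m ⟨i, hi⟩ else 0
    have h_extend : Function.Injective extend := by
      intro m m' hm
      funext i
      have := congrFun hm i.castSucc
      simpa [extend] using this
    have hbas : basAh (N + 1) h w =
        (fun r => Ideal.Quotient.mk (IAh (N + 1) h) (B fun i => r i)) ∘ extend := by
      funext m
      refine congrArg (Ideal.Quotient.mk (IAh (N + 1) h)) ?_
      simp only [B]
      rw [Fin.prod_univ_castSucc]
      simp [extend]
    rw [hbas]
    exact hli.comp extend h_extend
  · rw [eq_top_iff, ← hspan, Submodule.span_le]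
    rintro _ ⟨m, hm, rfl⟩
    refine Submodule.subset_span ⟨fun i => ⟨m (i.val + 1), Nat.lt_succ_of_le
      (hm (i.val + 1) (Finset.mem_Icc.2 (by omega)))⟩, ?_⟩
    have hm0 : m (N + 1) = 0 :=
      Nat.le_zero.1 (hlast ▸ hm (N + 1) (Finset.mem_Icc.2 (by omega)))
    rw [rootProd_one, Fin.prod_univ_castSucc]
    simp [basAh, map_prod, hm0]
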